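/- If p ∈ Q(H)^× satisfies e_μ(p) = e_{μ̄}(p) for every non-self-dual irreducible μ ∈ ℤ[H], then p ∈ Q(H)^{sym}. (Injectivity of the total homomorphism Θ in Proposition 5.1(2).) -/

import Mathlib

noncomputable section
open scoped nonZeroDivisors

/-- `H = H₁(Σ_{g,n}) ≅ ℤ^{n-1+2g}`, written as `H_∂ × Ĥ` with `Ĥ` carrying the
symplectic structure (two `Fin g` blocks). -/
abbrev SurfH (g n : ℕ) : Type := (Fin (n - 1) → ℤ) × ((Fin g → ℤ) × (Fin g → ℤ))

/-- The integral group ring `ℤ[H]`. -/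
abbrev GR (g n : ℕ) : Type := AddMonoidAlgebra ℤ (SurfH g n)

instance (g n : ℕ) : IsDomain (GR g n) := NoZeroDivisors.to_isDomain _

/-- The quotient field `Q(H)` of `ℤ[H]`. -/
abbrev QF (g n : ℕ) : Type := FractionRing (GR g n)

/-- The inclusion `ℤ[H] → Q(H)`. -/
abbrev incl (g n : ℕ) : GR g n →+* QF g n := algebraMap (GR g n) (QF g n)

/-- The standard symplectic form on `Ĥ = ℤ^{2g}`. -/
def symplForm {g : ℕ} (v w : (Fin g → ℤ) × (Fin g → ℤ)) : ℤ :=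
  (∑ i, v.1 i * w.2 i) - ∑ i, v.2 i * w.1 i

/-- `Aut*(H)`: automorphisms of `H` fixing `H_∂` pointwise and with block form
`[[I, *], [0, P₀]]`, `P₀ ∈ Sp(2g, ℤ)`. -/
def AutStar (g n : ℕ) : Set (SurfH g n ≃+ SurfH g n) :=
  {φ | (∀ x : Fin (n - 1) → ℤ, φ (x, 0) = (x, 0)) ∧
       ∀ v w : (Fin g → ℤ) × (Fin g → ℤ),
         symplForm (φ (0, v)).2 (φ (0, w)).2 = symplForm v w}

/-- The ring automorphism of `ℤ[H]` induced by an automorphism of `H`. -/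
def ringAut {g n : ℕ} (φ : SurfH g n ≃+ SurfH g n) : GR g n ≃+* GR g n :=
  (AddMonoidAlgebra.domCongr ℤ ℤ φ).toRingEquiv

/-- The field automorphism of `Q(H)` induced by a ring automorphism of `ℤ[H]`. -/
def fieldAut {g n : ℕ} (e : GR g n ≃+* GR g n) : QF g n ≃+* QF g n :=
  IsFractionRing.ringEquivOfRingEquiv e

/-- The involution `p ↦ p̄` of `ℤ[H]`, induced by `h ↦ h⁻¹`. -/
def barR (g n : ℕ) : GR g n ≃+* GR g n := ringAut (AddEquiv.neg (SurfH g n))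

/-- The involution `p ↦ p̄` of `Q(H)`. -/
def barQ (g n : ℕ) : QF g n ≃+* QF g n := fieldAut (barR g n)

/-- `p ≐ q`: `p = ±h·q` for some `h ∈ H`. -/
def doteq {g n : ℕ} (p q : QF g n) : Prop :=
  ∃ (u : ℤˣ) (h : SurfH g n), p = incl g n (AddMonoidAlgebra.single h (u : ℤ)) * q

/-- `p ∼ q`: `p ≐ φ(q)` for some `φ ∈ Aut*(H)`. -/
def sim (g n : ℕ) (p q : QF g n) : Prop :=
  ∃ φ ∈ AutStar g n, doteq p (fieldAut (ringAut φ) q)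

/-- The subgroup `A(H)` of `Q(H)^×` generated by all `±h·p⁻¹·φ(p)`. -/
def AH (g n : ℕ) : Subgroup (QF g n)ˣ :=
  Subgroup.closure {x : (QF g n)ˣ |
    ∃ (u : ℤˣ) (h : SurfH g n) (p : (QF g n)ˣ) (φ : SurfH g n ≃+ SurfH g n),
      φ ∈ AutStar g n ∧
      (x : QF g n) = incl g n (AddMonoidAlgebra.single h (u : ℤ)) * (↑p)⁻¹ *
        fieldAut (ringAut φ) ↑p}

/-- The subgroup `N(H) = {±h·q·q̄}` of `Q(H)^×`. -/
def NH (g n : ℕ) : Subgroup (QF g n)ˣ :=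
  Subgroup.closure {x : (QF g n)ˣ |
    ∃ (u : ℤˣ) (h : SurfH g n) (q : (QF g n)ˣ),
      (x : QF g n) = incl g n (AddMonoidAlgebra.single h (u : ℤ)) * ↑q * barQ g n ↑q}

/-- The involution on `Q(H)^×` as a group homomorphism. -/
def barU (g n : ℕ) : (QF g n)ˣ →* (QF g n)ˣ :=
  Units.map (barQ g n).toRingHom.toMonoidHom

/-- `Q(H)^{sym} = {p : p·A(H) = p̄·A(H)}`. -/
def Qsym (g n : ℕ) : Subgroup (QF g n)ˣ :=
  (AH g n).comap (barU g n / MonoidHom.id (QF g n)ˣ)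

open UniqueFactorizationMonoid in
/-- For irreducible `l`, the number of irreducible factors (with multiplicity) of
`r ∈ ℤ[H]` lying in the `∼`-class of `l`; this is `e_l` on `ℤ[H]`. -/
def eCount (g n : ℕ) [UniqueFactorizationMonoid (GR g n)] (l r : GR g n) : ℕ :=
  Multiset.card (@Multiset.filter _
    (fun m => sim g n (incl g n m) (incl g n l)) (Classical.decPred _) (factors r))

/-- `e_l(p)` for `p ∈ Q(H)^×`, via a choice of fraction representation. -/
def eOrb (g n : ℕ) [UniqueFactorizationMonoid (GR g n)] (l : GR g n) (p : QF g n) : ℤ :=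
  (eCount g n l (IsLocalization.sec (GR g n)⁰ p).1 : ℤ) -
    (eCount g n l ((IsLocalization.sec (GR g n)⁰ p).2 : GR g n) : ℤ)

section Units

open AddMonoidAlgebra in
/-- A group ring over a two-unique-sums group has only trivial units. -/
lemma AddMonoidAlgebra.exists_eq_single_of_isUnit {R G : Type*} [CommRing R] [IsDomain R]
    [AddGroup G] [TwoUniqueSums G] {w : AddMonoidAlgebra R G} (hw : IsUnit w) :
    ∃ (u : Rˣ) (h : G), w = single h (u : R) := by
  obtain ⟨v, hwv, -⟩ := isUnit_iff_exists.1 hw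
  have hsum : ∀ {a b : G}, a ∈ w.coeff.support → b ∈ v.coeff.support →
      UniqueAdd w.coeff.support v.coeff.support a b → a + b = 0 := by
    intro a b ha hb hab
    have h := coeff_mul_add_of_uniqueAdd hab
    rw [hwv] at h
    by_contra hne
    rw [AddMonoidAlgebra.one_def, coeff_single, Finsupp.single_eq_of_ne hne] at h
    exact mul_ne_zero (Finsupp.mem_support_iff.1 ha) (Finsupp.mem_support_iff.1 hb) h.symm
  have hcard : w.coeff.support.card * v.coeff.support.card ≤ 1 := by
    by_contra! hlt
    obtain ⟨p, hp, q, hq, hne, hup, huq⟩ := TwoUniqueSums.uniqueAdd_of_one_lt_card hlt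
    rw [Finset.mem_product] at hp hq
    have h := hup hq.1 hq.2 ((hsum hq.1 hq.2 huq).trans (hsum hp.1 hp.2 hup).symm)
    exact hne (Prod.ext h.1.symm h.2.symm)
  have hw0 : w.coeff.support.card ≠ 0 := by
    intro h
    obtain rfl : w = 0 := by simpa using h
    simp at hwv
  have hv0 : v.coeff.support.card ≠ 0 := by
    intro h
    obtain rfl : v = 0 := by simpa using h
    simp at hwv
  obtain ⟨hw1, hv1⟩ : w.coeff.support.card = 1 ∧ v.coeff.support.card = 1 :=
    mul_eq_one.1 (hcard.antisymm (Nat.mul_pos (Nat.pos_of_ne_zero hw0) (Nat.pos_of_ne_zero hv0)))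
  obtain ⟨h, r, -, hr⟩ := Finsupp.card_support_eq_one'.1 hw1
  obtain ⟨k, s, -, hs⟩ := Finsupp.card_support_eq_one'.1 hv1
  obtain rfl : w = single h r := AddMonoidAlgebra.ext hr
  obtain rfl : v = single k s := AddMonoidAlgebra.ext hs
  rw [single_mul_single] at hwv
  have h1 := congrArg coeff hwv
  rw [AddMonoidAlgebra.one_def, coeff_single, coeff_single, Finsupp.single_eq_single_iff] at h1
  have hrs : r * s = 1 := by
    have h2 : h + k = 0 ∧ r * s = 1 := by simpa using h1
    exact h2.2
  exact ⟨Units.mkOfMulEqOne r s hrs, h, rfl⟩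

end Units

section AutStar

variable {g n : ℕ}

lemma AutStar.snd_apply {φ : SurfH g n ≃+ SurfH g n} (hφ : φ ∈ AutStar g n) (z : SurfH g n) :
    (φ z).2 = (φ (0, z.2)).2 := by
  have h : z = (z.1, 0) + (0, z.2) := by simp
  conv_lhs => rw [h, map_add, hφ.1]
  simp

lemma AutStar.symplForm_apply {φ : SurfH g n ≃+ SurfH g n} (hφ : φ ∈ AutStar g n)
    (z w : SurfH g n) : symplForm (φ z).2 (φ w).2 = symplForm z.2 w.2 := by
  rw [AutStar.snd_apply hφ z, AutStar.snd_apply hφ w, hφ.2]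

lemma AutStar.refl_mem : AddEquiv.refl (SurfH g n) ∈ AutStar g n :=
  ⟨fun _ => rfl, fun _ _ => rfl⟩

lemma AutStar.trans_mem {φ ψ : SurfH g n ≃+ SurfH g n} (hφ : φ ∈ AutStar g n)
    (hψ : ψ ∈ AutStar g n) : φ.trans ψ ∈ AutStar g n :=
  ⟨fun x => by simp [hφ.1 x, hψ.1 x], fun v w => by
    simpa [AutStar.symplForm_apply hψ] using hφ.2 v w⟩

lemma AutStar.symm_mem {φ : SurfH g n ≃+ SurfH g n} (hφ : φ ∈ AutStar g n) :
    φ.symm ∈ AutStar g n :=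
  ⟨fun x => by rw [AddEquiv.symm_apply_eq, hφ.1], fun v w => by
    rw [← AutStar.symplForm_apply hφ]; simp⟩

end AutStar

section Action

variable {g n : ℕ}

@[simp] lemma fieldAut_incl (e : GR g n ≃+* GR g n) (x : GR g n) :
    fieldAut e (incl g n x) = incl g n (e x) :=
  IsFractionRing.ringEquivOfRingEquiv_algebraMap e x

@[simp] lemma ringAut_single (φ : SurfH g n ≃+ SurfH g n) (h : SurfH g n) (r : ℤ) :
    ringAut φ (AddMonoidAlgebra.single h r) = AddMonoidAlgebra.single (φ h) r := by
  simp [ringAut]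

lemma ringAut_ringAut (φ ψ : SurfH g n ≃+ SurfH g n) (x : GR g n) :
    ringAut φ (ringAut ψ x) = ringAut (ψ.trans φ) x := by
  induction x using AddMonoidAlgebra.induction_linear with
  | zero => simp
  | add x y hx hy => simp [hx, hy]
  | single h r => simp

lemma fieldAut_ringAut_fieldAut_ringAut (φ ψ : SurfH g n ≃+ SurfH g n) (q : QF g n) :
    fieldAut (ringAut φ) (fieldAut (ringAut ψ) q) = fieldAut (ringAut (ψ.trans φ)) q := by
  obtain ⟨a, b, -, rfl⟩ := IsFractionRing.div_surjective (A := GR g n) q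
  simp only [map_div₀, fieldAut_incl, ringAut_ringAut]

lemma fieldAut_ringAut_refl (q : QF g n) :
    fieldAut (ringAut (AddEquiv.refl (SurfH g n))) q = q := by
  have h (x : GR g n) : ringAut (AddEquiv.refl (SurfH g n)) x = x := by simp [ringAut]
  obtain ⟨a, b, -, rfl⟩ := IsFractionRing.div_surjective (A := GR g n) q
  simp only [map_div₀, fieldAut_incl, h]

lemma barQ_fieldAut (φ : SurfH g n ≃+ SurfH g n) (q : QF g n) :
    barQ g n (fieldAut (ringAut φ) q) = fieldAut (ringAut φ) (barQ g n q) := by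
  simp only [barQ, barR, fieldAut_ringAut_fieldAut_ringAut]
  congr 3
  ext1 h
  simp

@[simp] lemma barQ_barQ (q : QF g n) : barQ g n (barQ g n q) = q := by
  have h : (AddEquiv.neg (SurfH g n)).trans (AddEquiv.neg _) = AddEquiv.refl _ := by
    ext1 h
    simp
  simp only [barQ, barR, fieldAut_ringAut_fieldAut_ringAut, h, fieldAut_ringAut_refl]

lemma barQ_incl (x : GR g n) : barQ g n (incl g n x) = incl g n (barR g n x) :=
  fieldAut_incl _ x

/-- The element `±h` of `Q(H)`. -/
def monomialQ (u : ℤˣ) (h : SurfH g n) : QF g n :=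
  incl g n (AddMonoidAlgebra.single h (u : ℤ))

lemma monomialQ_mul (u v : ℤˣ) (h k : SurfH g n) :
    monomialQ u h * monomialQ v k = monomialQ (u * v) (h + k) := by
  simp [monomialQ, ← map_mul, AddMonoidAlgebra.single_mul_single]

lemma monomialQ_one_zero : monomialQ (1 : ℤˣ) (0 : SurfH g n) = 1 := by
  have h : (AddMonoidAlgebra.single 0 1 : GR g n) = 1 := rfl
  simp [monomialQ, h]

lemma monomialQ_inv_mul (u : ℤˣ) (h : SurfH g n) :
    monomialQ u⁻¹ (-h) * monomialQ u h = 1 := by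
  rw [monomialQ_mul, inv_mul_cancel, neg_add_cancel, monomialQ_one_zero]

lemma fieldAut_monomialQ (φ : SurfH g n ≃+ SurfH g n) (u : ℤˣ) (h : SurfH g n) :
    fieldAut (ringAut φ) (monomialQ u h) = monomialQ u (φ h) := by
  simp only [monomialQ, fieldAut_incl, ringAut_single]

end Action

section Sim

variable {g n : ℕ}

lemma sim_iff {p q : QF g n} : sim g n p q ↔
    ∃ φ ∈ AutStar g n, ∃ u h, p = monomialQ u h * fieldAut (ringAut φ) q := Iff.rfl

lemma sim_refl (p : QF g n) : sim g n p p :=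
  sim_iff.2 ⟨_, AutStar.refl_mem, 1, 0, by
    rw [monomialQ_one_zero, one_mul, fieldAut_ringAut_refl]⟩

lemma sim_symm {p q : QF g n} (hpq : sim g n p q) : sim g n q p := by
  obtain ⟨φ, hφ, u, h, rfl⟩ := sim_iff.1 hpq
  refine sim_iff.2 ⟨φ.symm, AutStar.symm_mem hφ, u⁻¹, -φ.symm h, ?_⟩
  rw [map_mul, fieldAut_monomialQ, fieldAut_ringAut_fieldAut_ringAut, ← mul_assoc,
    monomialQ_inv_mul, one_mul, AddEquiv.self_trans_symm, fieldAut_ringAut_refl]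

lemma sim_trans {p q r : QF g n} (hpq : sim g n p q) (hqr : sim g n q r) : sim g n p r := by
  obtain ⟨φ, hφ, u, h, rfl⟩ := sim_iff.1 hpq
  obtain ⟨ψ, hψ, v, k, rfl⟩ := sim_iff.1 hqr
  refine sim_iff.2 ⟨ψ.trans φ, AutStar.trans_mem hψ hφ, u * v, h + φ k, ?_⟩
  rw [map_mul, fieldAut_monomialQ, fieldAut_ringAut_fieldAut_ringAut, ← mul_assoc,
    monomialQ_mul]

lemma sim_barQ {p q : QF g n} (hpq : sim g n p q) : sim g n (barQ g n p) (barQ g n q) := by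
  obtain ⟨φ, hφ, u, h, rfl⟩ := sim_iff.1 hpq
  refine sim_iff.2 ⟨φ, hφ, u, -h, ?_⟩
  rw [map_mul, barQ_fieldAut, barQ, barR, fieldAut_monomialQ]
  rfl

variable (g n) in
/-- The relation `∼` as a setoid on `Q(H)`. -/
def simSetoid : Setoid (QF g n) where
  r := sim g n
  iseqv := ⟨sim_refl, sim_symm, sim_trans⟩

variable (g n) in
/-- The set of `∼`-classes in `Q(H)`. -/
abbrev SimClass : Type := Quotient (simSetoid g n)

/-- The `∼`-class of an element of `ℤ[H]`. -/
def simClass (x : GR g n) : SimClass g n := Quotient.mk (simSetoid g n) (incl g n x)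

lemma simClass_eq_iff {x y : GR g n} :
    simClass x = simClass y ↔ sim g n (incl g n x) (incl g n y) :=
  Quotient.eq (r := simSetoid g n)

/-- The involution on `∼`-classes. -/
def barClass : SimClass g n → SimClass g n :=
  Quotient.map (barQ g n) fun _ _ h => sim_barQ h

@[simp] lemma barClass_barClass (c : SimClass g n) : barClass (barClass c) = c := by
  induction c using Quotient.inductionOn with
  | h q => exact congrArg (Quotient.mk (simSetoid g n)) (barQ_barQ q)

lemma barClass_simClass (x : GR g n) : barClass (simClass x) = simClass (barR g n x) :=
  congrArg (Quotient.mk (simSetoid g n)) (barQ_incl x)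

lemma barClass_injective : Function.Injective (barClass (g := g) (n := n)) :=
  Function.LeftInverse.injective barClass_barClass

open Classical in
lemma count_map_barClass (s : Multiset (SimClass g n)) (c : SimClass g n) :
    (s.map barClass).count c = s.count (barClass c) := by
  rw [← barClass_barClass c, Multiset.count_map_eq_count' _ _ barClass_injective,
    barClass_barClass]

end Sim

section Quotient

variable {g n : ℕ}

variable (g n) in
/-- The quotient group `Q(H)^× / A(H)`. -/
def TorsionGroup : Type := (QF g n)ˣ ⧸ AH g n

instance : CommGroup (TorsionGroup g n) :=
  inferInstanceAs (CommGroup ((QF g n)ˣ ⧸ AH g n))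

/-- The projection `Q(H)^× → Q(H)^× / A(H)`. -/
def torsionMk : (QF g n)ˣ →* TorsionGroup g n := QuotientGroup.mk' (AH g n)

lemma torsionMk_eq_iff {p q : (QF g n)ˣ} : torsionMk p = torsionMk q ↔ p⁻¹ * q ∈ AH g n :=
  QuotientGroup.eq

lemma torsionMk_eq_of_sim {p q : (QF g n)ˣ} (h : sim g n (p : QF g n) q) :
    torsionMk p = torsionMk q := by
  obtain ⟨φ, hφ, u, k, hpq⟩ := h
  symm
  rw [torsionMk_eq_iff]
  refine Subgroup.subset_closure ⟨u, k, q, φ, hφ, ?_⟩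
  rw [Units.val_mul, hpq, Units.val_inv_eq_inv_val]
  ring

open Classical in
/-- The class in `Q(H)^× / A(H)` of an element of `Q(H)`, with value `1` at `0`. -/
def torsionClass (q : QF g n) : TorsionGroup g n :=
  if hq : q = 0 then 1 else torsionMk (Units.mk0 q hq)

lemma torsionClass_val (q : (QF g n)ˣ) : torsionClass (q : QF g n) = torsionMk q := by
  simp [torsionClass]

lemma torsionClass_one : torsionClass (1 : QF g n) = 1 := by
  simpa using torsionClass_val (1 : (QF g n)ˣ)

lemma torsionClass_mul {p q : QF g n} (hp : p ≠ 0) (hq : q ≠ 0) :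
    torsionClass (p * q) = torsionClass p * torsionClass q := by
  lift p to (QF g n)ˣ using hp.isUnit
  lift q to (QF g n)ˣ using hq.isUnit
  rw [← Units.val_mul]
  simp only [torsionClass_val, map_mul]

lemma torsionClass_eq_of_sim {p q : QF g n} (h : sim g n p q) :
    torsionClass p = torsionClass q := by
  by_cases hq : q = 0
  · obtain ⟨φ, -, u, k, rfl⟩ := h
    simp [hq]
  · have hp : p ≠ 0 := by
      rintro rfl
      obtain ⟨φ, -, u, k, rfl⟩ := sim_symm h
      simp at hq
    lift p to (QF g n)ˣ using hp.isUnit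
    lift q to (QF g n)ˣ using IsUnit.mk0 _ hq
    rw [torsionClass_val, torsionClass_val, torsionMk_eq_of_sim h]

/-- The map induced by `torsionClass` on `∼`-classes. -/
def classValue : SimClass g n → TorsionGroup g n :=
  Quotient.lift torsionClass fun _ _ h => torsionClass_eq_of_sim h

lemma incl_ne_zero {x : GR g n} (hx : x ≠ 0) : incl g n x ≠ 0 := by
  simpa using hx

lemma torsionClass_incl_of_isUnit {w : GR g n} (hw : IsUnit w) :
    torsionClass (incl g n w) = 1 := by
  obtain ⟨u, h, rfl⟩ := AddMonoidAlgebra.exists_eq_single_of_isUnit hw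
  rw [← torsionClass_one]
  exact torsionClass_eq_of_sim
    (sim_iff.2 ⟨_, AutStar.refl_mem, u, h, by rw [map_one, mul_one, monomialQ]⟩)

lemma torsionClass_incl_multiset_prod (s : Multiset (GR g n)) (hs : (0 : GR g n) ∉ s) :
    torsionClass (incl g n s.prod) = (s.map fun x => torsionClass (incl g n x)).prod := by
  induction s using Multiset.induction_on with
  | empty => simp [torsionClass_one]
  | cons a s ih =>
    rw [Multiset.mem_cons, not_or] at hs
    rw [Multiset.prod_cons, Multiset.map_cons, Multiset.prod_cons, map_mul,
      torsionClass_mul (incl_ne_zero (Ne.symm hs.1))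
        (incl_ne_zero (Multiset.prod_ne_zero hs.2)), ih hs.2]

lemma torsionClass_incl_of_associated {s : Multiset (GR g n)} (hs : (0 : GR g n) ∉ s)
    {a : GR g n} (ha : Associated s.prod a) :
    torsionClass (incl g n a) = ((s.map simClass).map classValue).prod := by
  obtain ⟨w, rfl⟩ := ha
  rw [map_mul, torsionClass_mul (incl_ne_zero (Multiset.prod_ne_zero hs))
    (incl_ne_zero w.ne_zero), torsionClass_incl_of_isUnit w.isUnit, mul_one,
    torsionClass_incl_multiset_prod s hs, Multiset.map_map]
  rfl

end Quotient

section Factors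

open UniqueFactorizationMonoid

variable {g n : ℕ} [UniqueFactorizationMonoid (GR g n)]

/-- The multiset of `∼`-classes of the irreducible factors of `a`. -/
def factorClasses (a : GR g n) : Multiset (SimClass g n) := (factors a).map simClass

lemma torsionClass_incl {a : GR g n} (ha : a ≠ 0) :
    torsionClass (incl g n a) = ((factorClasses a).map classValue).prod :=
  torsionClass_incl_of_associated (fun h => (irreducible_of_factor _ h).ne_zero rfl)
    (factors_prod ha)

lemma torsionClass_incl_barR {a : GR g n} (ha : a ≠ 0) :
    torsionClass (incl g n (barR g n a)) =
      (((factorClasses a).map barClass).map classValue).prod := by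
  have hs : (0 : GR g n) ∉ (factors a).map (barR g n) := by
    intro h
    obtain ⟨x, hx, hx0⟩ := Multiset.mem_map.1 h
    exact (irreducible_of_factor _ hx).ne_zero (by simpa using hx0)
  have hassoc : Associated ((factors a).map (barR g n)).prod (barR g n a) := by
    rw [← map_multiset_prod]
    exact (factors_prod ha).map (barR g n)
  rw [torsionClass_incl_of_associated hs hassoc, factorClasses]
  simp only [Multiset.map_map, Function.comp_def, barClass_simClass]

open Classical in
lemma count_factorClasses (l a : GR g n) :
    (factorClasses a).count (simClass l) = eCount g n l a := by
  rw [factorClasses, Multiset.count_map, eCount]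
  congr 1
  refine Multiset.filter_congr fun x _ => ?_
  rw [eq_comm, simClass_eq_iff]

lemma exists_irreducible_of_mem_factorClasses {c : SimClass g n} {a : GR g n}
    (hc : c ∈ factorClasses a) : ∃ l : GR g n, Irreducible l ∧ simClass l = c := by
  obtain ⟨l, hl, rfl⟩ := Multiset.mem_map.1 hc
  exact ⟨l, irreducible_of_factor _ hl, rfl⟩

lemma factorClasses_add_eq {a b : GR g n}
    (hbal : ∀ μ : GR g n, Irreducible μ →
      ¬ sim g n (incl g n μ) (incl g n (barR g n μ)) →
      (eCount g n μ a : ℤ) - eCount g n μ b =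
        eCount g n (barR g n μ) a - eCount g n (barR g n μ) b) :
    factorClasses a + (factorClasses b).map barClass =
      (factorClasses a).map barClass + factorClasses b := by
  classical
  ext c
  simp only [Multiset.count_add, count_map_barClass]
  by_cases hc : ∃ l : GR g n, Irreducible l ∧ simClass l = c
  · obtain ⟨l, hl, rfl⟩ := hc
    by_cases hself : sim g n (incl g n l) (incl g n (barR g n l))
    · rw [barClass_simClass, ← simClass_eq_iff.2 hself]
    · have h := hbal l hl hself
      simp only [barClass_simClass, count_factorClasses]
      omega
  · have hc' : ¬ ∃ l : GR g n, Irreducible l ∧ simClass l = barClass c := by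
      rintro ⟨l, hl, hlc⟩
      refine hc ⟨barR g n l, (MulEquiv.irreducible_iff (barR g n)).2 hl, ?_⟩
      rw [← barClass_simClass, hlc, barClass_barClass]
    have h (x : GR g n) : (factorClasses x).count c = 0 :=
      Multiset.count_eq_zero.2 fun hx => hc (exists_irreducible_of_mem_factorClasses hx)
    have h' (x : GR g n) : (factorClasses x).count (barClass c) = 0 :=
      Multiset.count_eq_zero.2 fun hx => hc' (exists_irreducible_of_mem_factorClasses hx)
    simp [h, h']

end Factors

/-- **Injectivity of `Θ` in Proposition 5.1 (2).**
If `p ∈ Q(H)^×` satisfies `e_μ(p) = e_{μ̄}(p)` for every non-self-dual irreducible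
`μ ∈ ℤ[H]`, then `p ∈ Q(H)^{sym}`. -/
theorem torsion_theta_injective
    (g n : ℕ) (hH : 1 ≤ (n - 1) + 2 * g)
    [UniqueFactorizationMonoid (GR g n)]
    (p : (QF g n)ˣ)
    (hbal : ∀ μ : GR g n, Irreducible μ →
      ¬ sim g n (incl g n μ) (incl g n (barR g n μ)) →
      eOrb g n μ (p : QF g n) = eOrb g n (barR g n μ) (p : QF g n)) :
    p ∈ Qsym g n := by
  obtain ⟨a, b, hp, hb, ha, hab⟩ : ∃ a b : GR g n, (p : QF g n) * incl g n b = incl g n a ∧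
      b ≠ 0 ∧ a ≠ 0 ∧ factorClasses a + (factorClasses b).map barClass =
        (factorClasses a).map barClass + factorClasses b := by
    have hb := nonZeroDivisors.coe_ne_zero (IsLocalization.sec (GR g n)⁰ (p : QF g n)).2
    have hp := IsLocalization.sec_spec (GR g n)⁰ (p : QF g n)
    refine ⟨_, _, hp, hb, fun h0 => ?_, factorClasses_add_eq hbal⟩
    rw [h0, map_zero] at hp
    exact mul_ne_zero p.ne_zero (incl_ne_zero hb) hp
  have hprod := congrArg (fun s => (s.map classValue).prod) hab
  simp only [Multiset.map_add, Multiset.prod_add, ← torsionClass_incl ha,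
    ← torsionClass_incl hb, ← torsionClass_incl_barR ha, ← torsionClass_incl_barR hb] at hprod
  have hbarp : ((barU g n p : (QF g n)ˣ) : QF g n) * incl g n (barR g n b) =
      incl g n (barR g n a) := by
    rw [← barQ_incl, ← barQ_incl, ← hp, map_mul]
    rfl
  have hb' : barR g n b ≠ 0 := by simpa using hb
  rw [← hp, ← hbarp, torsionClass_mul p.ne_zero (incl_ne_zero hb),
    torsionClass_mul (Units.ne_zero _) (incl_ne_zero hb'), torsionClass_val,
    torsionClass_val] at hprod
  have hclass : torsionMk p = torsionMk (barU g n p) := by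
    rw [mul_assoc, mul_assoc, mul_comm (torsionClass (incl g n b))] at hprod
    exact mul_right_cancel hprod
  rw [torsionMk_eq_iff] at hclass
  rw [Qsym, Subgroup.mem_comap, MonoidHom.div_apply, MonoidHom.id_apply, div_eq_inv_mul]
  exact hclass
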